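/- Let Y be a regular sublattice of an Archimedean vector lattice X. If Y is dense in X with respect to order convergence (every vector of X is the order limit in X of some net contained in Y), then Y is order dense in X. If, in addition, Y is order complete in its own right, then Y is an ideal of X. -/

import Mathlib

open Filter Finset

universe u v

section Defs

variable {X : Type*} [Lattice X] [AddCommGroup X]

/-- Order convergence of a net `x` to `l`: there is a downward directed set `A` of
dominating elements with infimum `0` (playing the role of a net `(a_γ)` with `a_γ ↓ 0`)
such that for every `a ∈ A`, eventually `|x α - l| ≤ a`. -/
def OConv {ι : Type*} [Preorder ι] (x : ι → X) (l : X) : Prop :=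
  ∃ A : Set X, A.Nonempty ∧ DirectedOn (· ≥ ·) A ∧ IsGLB A 0 ∧
    ∀ a ∈ A, ∃ α₀, ∀ α, α₀ ≤ α → |x α - l| ≤ a

/-- Unbounded order (uo-) convergence: `|x α - l| ⊓ u →o 0` for every `u ≥ 0`. -/
def UoConv {ι : Type*} [Preorder ι] (x : ι → X) (l : X) : Prop :=
  ∀ u : X, 0 ≤ u → OConv (fun α => |x α - l| ⊓ u) (0 : X)

/-- Order Cauchy: the double net `(x α - x β)` order converges to `0`. -/
def OCauchy {ι : Type*} [Preorder ι] (x : ι → X) : Prop :=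
  OConv (fun p : ι × ι => x p.1 - x p.2) (0 : X)

/-- uo-Cauchy: the double net `(x α - x β)` uo-converges to `0`. -/
def UoCauchy {ι : Type*} [Preorder ι] (x : ι → X) : Prop :=
  UoConv (fun p : ι × ι => x p.1 - x p.2) (0 : X)

/-- `l` is the greatest lower bound of `A` relative to the subset `Y`. -/
def IsGLBOn (Y A : Set X) (l : X) : Prop :=
  l ∈ Y ∧ l ∈ lowerBounds A ∧ ∀ y ∈ Y, y ∈ lowerBounds A → y ≤ l

/-- `l` is the least upper bound of `A` relative to the subset `Y`. -/
def IsLUBOn (Y A : Set X) (l : X) : Prop :=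
  l ∈ Y ∧ l ∈ upperBounds A ∧ ∀ y ∈ Y, y ∈ upperBounds A → l ≤ y

/-- `Y` is regular in `X`: infima of subsets of `Y` computed in `Y` are also infima in `X`. -/
def RegularIn (Y : Set X) : Prop :=
  ∀ A : Set X, A ⊆ Y → ∀ l : X, IsGLBOn Y A l → IsGLB A l

/-- Order convergence relative to the sublattice `Y`
(dominating set contained in `Y`, with infimum `0` computed in `Y`). -/
def OConvOn (Y : Set X) {ι : Type*} [Preorder ι] (x : ι → X) (l : X) : Prop :=
  ∃ A : Set X, A ⊆ Y ∧ A.Nonempty ∧ DirectedOn (· ≥ ·) A ∧ IsGLBOn Y A 0 ∧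
    ∀ a ∈ A, ∃ α₀, ∀ α, α₀ ≤ α → |x α - l| ≤ a

/-- uo-convergence relative to the sublattice `Y` (test vectors taken in `Y`). -/
def UoConvOn (Y : Set X) {ι : Type*} [Preorder ι] (x : ι → X) (l : X) : Prop :=
  ∀ u ∈ Y, 0 ≤ u → OConvOn Y (fun α => |x α - l| ⊓ u) (0 : X)

end Defs

/-- Cesàro means of a sequence: `cesaro x n = (1/(n+1)) • (x 0 + ⋯ + x n)`. -/
noncomputable def cesaro {X : Type*} [AddCommGroup X] [Module ℝ X] (x : ℕ → X) (n : ℕ) : X :=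
  ((n + 1 : ℝ))⁻¹ • ∑ i ∈ Finset.range (n + 1), x i

section Helpers

variable {X : Type*} [Lattice X] [AddCommGroup X] [CovariantClass X X (· + ·) (· ≤ ·)]

/-- In an Archimedean lattice-ordered group, the differences between the elements of a set
bounded below in `Y` and its lower bounds in `Y` have infimum `0` in `Y`. -/
theorem isGLBOn_sub_lowerBounds
    (hArch : ∀ a b : X, (∀ n : ℕ, n • a ≤ b) → a ≤ 0) {Y T : Set X} (hY0 : (0 : X) ∈ Y)
    (hYadd : ∀ a ∈ Y, ∀ b ∈ Y, a + b ∈ Y) (hT : T.Nonempty)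
    (hbdd : ∃ l ∈ Y, l ∈ lowerBounds T) :
    IsGLBOn Y {x | ∃ t ∈ T, ∃ l ∈ Y, l ∈ lowerBounds T ∧ x = t - l} 0 := by
  refine ⟨hY0, ?_, ?_⟩
  · rintro _ ⟨t, ht, l, -, hl, rfl⟩
    exact sub_nonneg.2 (hl ht)
  · intro d hd hlow
    obtain ⟨l, hlY, hl⟩ := hbdd
    obtain ⟨t, ht⟩ := hT
    have key : ∀ n : ℕ, l + n • d ∈ Y ∧ l + n • d ∈ lowerBounds T := by
      intro n
      induction n with
      | zero => simpa using ⟨hlY, hl⟩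
      | succ k ih =>
        rw [succ_nsmul, ← add_assoc]
        refine ⟨hYadd _ ih.1 _ hd, fun s hs => ?_⟩
        exact le_sub_iff_add_le'.1 (hlow ⟨s, hs, _, ih.1, ih.2, rfl⟩)
    exact hArch d (t - l) fun n => le_sub_iff_add_le'.2 ((key n).2 ht)

/-- A positive order limit of a net in a regular sublattice `Y` dominates a positive element
of `Y`. -/
theorem exists_pos_le_of_oConv
    (hArch : ∀ a b : X, (∀ n : ℕ, n • a ≤ b) → a ≤ 0) {Y : Set X} (hY0 : (0 : X) ∈ Y)
    (hYadd : ∀ a ∈ Y, ∀ b ∈ Y, a + b ∈ Y) (hYneg : ∀ a ∈ Y, -a ∈ Y)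
    (hYsup : ∀ a ∈ Y, ∀ b ∈ Y, a ⊔ b ∈ Y) (hreg : RegularIn Y)
    {ι : Type*} [Preorder ι] (hdir : ∀ a b : ι, ∃ c : ι, a ≤ c ∧ b ≤ c)
    {f : ι → X} (hfY : ∀ α, f α ∈ Y) {z : X} (hf : OConv f z) (hz : 0 < z) :
    ∃ y ∈ Y, 0 < y ∧ y ≤ z := by
  by_contra! hno
  obtain ⟨A, -, -, hA0, hA⟩ := hf
  refine hz.not_ge (hA0.2 fun a ha => ?_)
  obtain ⟨α₀, hα₀⟩ := hA a ha
  set T : Set X := {x | ∃ α, α₀ ≤ α ∧ x = f α ⊔ 0}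
  have hTY : T ⊆ Y := by
    rintro _ ⟨α, -, rfl⟩
    exact hYsup _ (hfY α) _ hY0
  have hglb := hreg _ ?_ _ (isGLBOn_sub_lowerBounds hArch hY0 hYadd
    (T := T) ⟨_, α₀, le_rfl, rfl⟩ ⟨0, hY0, ?_⟩)
  · rw [← sub_nonpos]
    refine hglb.2 ?_
    rintro _ ⟨_, ⟨α, hα, rfl⟩, l, hlY, hl, rfl⟩
    have hlz : l ≤ z := by
      rw [← sub_nonpos]
      refine hA0.2 fun a' ha' => ?_
      obtain ⟨α₁, hα₁⟩ := hA a' ha'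
      obtain ⟨β, hβ₀, hβ₁⟩ := hdir α₀ α₁
      have ha'0 : 0 ≤ a' := hA0.1 ha'
      have h1 : f β ≤ a' + z := sub_le_iff_le_add.1 ((le_abs_self _).trans (hα₁ β hβ₁))
      exact sub_le_iff_le_add.2
        ((hl ⟨β, hβ₀, rfl⟩).trans (sup_le h1 (add_nonneg ha'0 hz.le)))
    have hl0 : l ≤ 0 := by
      by_contra hl0
      refine hno (l ⊔ 0) (hYsup _ hlY _ hY0) ?_ (sup_le hlz hz.le)
      exact lt_of_le_of_ne le_sup_right fun h => hl0 (h ▸ le_sup_left)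
    have h2 : z - f α ≤ a := (le_abs_self _).trans ((abs_sub_comm _ _).trans_le (hα₀ α hα))
    calc z - a ≤ f α := sub_le_comm.1 h2
      _ ≤ f α ⊔ 0 := le_sup_left
      _ ≤ f α ⊔ 0 - l := le_sub_self_iff _ |>.2 hl0
  · rintro _ ⟨t, ht, l, hlY, -, rfl⟩
    rw [sub_eq_add_neg]
    exact hYadd _ (hTY ht) _ (hYneg _ hlY)
  · rintro _ ⟨α, -, rfl⟩
    exact le_sup_right

/-- Suprema computed in a regular subgroup are suprema in the whole space. -/
theorem RegularIn.isLUB {Y : Set X} (hreg : RegularIn Y) (hYneg : ∀ a ∈ Y, -a ∈ Y)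
    {S : Set X} (hS : S ⊆ Y) {l : X} (hl : IsLUBOn Y S l) : IsLUB S l := by
  have h : IsGLB (-S) (-l) := by
    refine hreg _ (fun x hx => ?_) _ ⟨hYneg _ hl.1, fun x hx => ?_, fun y hy hlow => ?_⟩
    · simpa using hYneg _ (hS hx)
    · exact neg_le.1 (hl.2.1 hx)
    · refine le_neg.1 (hl.2.2 _ (hYneg _ hy) fun x hx => le_neg.1 (hlow ?_))
      simpa using hx
  simpa using h

/-- An order complete, order dense, regular subgroup contains every positive vector dominated
by one of its elements. -/
theorem mem_of_nonneg_of_le {Y : Set X} (hY0 : (0 : X) ∈ Y)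
    (hYadd : ∀ a ∈ Y, ∀ b ∈ Y, a + b ∈ Y) (hYneg : ∀ a ∈ Y, -a ∈ Y) (hreg : RegularIn Y)
    (hod : ∀ z : X, 0 < z → ∃ y ∈ Y, 0 < y ∧ y ≤ z)
    (hcomp : ∀ A : Set X, A ⊆ Y → A.Nonempty → (∃ u ∈ Y, u ∈ upperBounds A) →
      ∃ l : X, IsLUBOn Y A l)
    {a b : X} (hb : b ∈ Y) (ha : 0 ≤ a) (hab : a ≤ b) : a ∈ Y := by
  have hSY : {y | y ∈ Y ∧ y ≤ a} ⊆ Y := fun y hy => hy.1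
  obtain ⟨l, hl⟩ := hcomp _ hSY ⟨0, hY0, ha⟩ ⟨b, hb, fun y hy => hy.2.trans hab⟩
  have hla : l ≤ a := (hreg.isLUB hYneg hSY hl).2 fun y hy => hy.2
  rcases hla.eq_or_lt with rfl | hlt
  · exact hl.1
  · obtain ⟨y, hyY, hy0, hy⟩ := hod _ (sub_pos.2 hlt)
    have : l + y ≤ l := hl.2.1 ⟨hYadd _ hl.1 _ hyY, le_sub_iff_add_le'.1 hy⟩
    exact absurd (add_le_iff_nonpos_right l |>.1 this) hy0.not_ge

end Helpers

/-- Let `Y` be a regular sublattice of an Archimedean vector lattice `X`.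
If every vector of `X` is the order limit (in `X`) of a net contained in `Y`, then `Y`
is order dense in `X`; if, in addition, `Y` is order complete in its own right, then `Y`
is an ideal of `X` (i.e. it is solid). -/
theorem regular_oDense_of_denseOrderConv
    {X : Type u} [Lattice X] [AddCommGroup X] [Module ℝ X]
    [CovariantClass X X (· + ·) (· ≤ ·)] [PosSMulMono ℝ X]
    (hArch : ∀ a b : X, (∀ n : ℕ, n • a ≤ b) → a ≤ 0)
    (Y : Set X) (hY0 : (0 : X) ∈ Y)
    (hYadd : ∀ a ∈ Y, ∀ b ∈ Y, a + b ∈ Y)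
    (hYsmul : ∀ (c : ℝ), ∀ a ∈ Y, c • a ∈ Y)
    (hYsup : ∀ a ∈ Y, ∀ b ∈ Y, a ⊔ b ∈ Y)
    (hYinf : ∀ a ∈ Y, ∀ b ∈ Y, a ⊓ b ∈ Y)
    (hreg : RegularIn Y)
    (hdense : ∀ z : X, ∃ (ι : Type u) (pι : Preorder ι), Nonempty ι ∧
      (∀ a b : ι, ∃ c : ι, pι.le a c ∧ pι.le b c) ∧
      ∃ f : ι → X, (∀ α, f α ∈ Y) ∧ @OConv X _ _ ι pι f z) :
    (∀ z : X, 0 < z → ∃ y ∈ Y, 0 < y ∧ y ≤ z) ∧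
    ((∀ A : Set X, A ⊆ Y → A.Nonempty → (∃ u ∈ Y, u ∈ upperBounds A) →
        ∃ l : X, IsLUBOn Y A l) →
      ∀ a b : X, b ∈ Y → |a| ≤ |b| → a ∈ Y) := by
  have hYneg : ∀ a ∈ Y, -a ∈ Y := fun a ha => by simpa using hYsmul (-1) a ha
  have hod : ∀ z : X, 0 < z → ∃ y ∈ Y, 0 < y ∧ y ≤ z := by
    intro z hz
    obtain ⟨ι, pι, -, hdir, f, hfY, hf⟩ := hdense z
    exact exists_pos_le_of_oConv hArch hY0 hYadd hYneg hYsup hreg hdir hfY hf hz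
  refine ⟨hod, fun hcomp a b hb hab => ?_⟩
  have hbY : |b| ∈ Y := hYsup _ hb _ (hYneg _ hb)
  have hmem : ∀ {c : X}, 0 ≤ c → c ≤ |b| → c ∈ Y :=
    mem_of_nonneg_of_le hY0 hYadd hYneg hreg hod hcomp hbY
  have hpos : a⁺ ∈ Y :=
    hmem (posPart_nonneg a) ((sup_le (le_abs_self a) (abs_nonneg a)).trans hab)
  have hneg : a⁻ ∈ Y :=
    hmem (negPart_nonneg a) ((sup_le (neg_le_abs a) (abs_nonneg a)).trans hab)
  rw [← posPart_sub_negPart a, sub_eq_add_neg]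
  exact hYadd _ hpos _ (hYneg _ hneg)
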